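/- arXiv:2212.02294 — 3 statements merged into one kernel-verified Lean document; each statement's English description precedes it below -/
import Mathlib

section
/- Suppose v̂ ∈ ℝᵐ is a centered point for parameter μ > 0 and v ≠ v̂. Let d = d(v,μ) ≠ 0 be the Newton direction at v, define f(t) := h(v̂, v + t·d), fix β ∈ (0,1), and set α = max(1, ‖d‖∞²/(2β)). Then f(1/α) < f(0). -/
open Matrix

/-- Elementwise exponentiation `e^v` of a vector. -/
noncomputable def expV {m : ℕ} (v : Fin m → ℝ) : Fin m → ℝ := fun i => Real.exp (v i)

/-- The log-domain Newton system: `(d, x)` satisfies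
`√μ·Aᵀ(eᵛ + eᵛ∘d) = Wx + c` and `√μ·(e^{−v} − e^{−v}∘d) = Ax + b`. -/
noncomputable def IsNewton {m n : ℕ} (A : Matrix (Fin m) (Fin n) ℝ) (b : Fin m → ℝ)
    (c : Fin n → ℝ) (W : Matrix (Fin n) (Fin n) ℝ) (μ : ℝ) (v d : Fin m → ℝ)
    (x : Fin n → ℝ) : Prop :=
  Real.sqrt μ • (Aᵀ).mulVec (expV v + expV v * d) = W.mulVec x + c ∧
  Real.sqrt μ • (expV (-v) - expV (-v) * d) = A.mulVec x + b

/-- `v` is a centered point for parameter `μ`, witnessed by `x`: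
`√μ·Aᵀeᵛ = Wx + c` and `√μ·e^{−v} = Ax + b`. -/
noncomputable def IsCentered {m n : ℕ} (A : Matrix (Fin m) (Fin n) ℝ) (b : Fin m → ℝ)
    (c : Fin n → ℝ) (W : Matrix (Fin n) (Fin n) ℝ) (μ : ℝ) (v : Fin m → ℝ)
    (x : Fin n → ℝ) : Prop :=
  Real.sqrt μ • (Aᵀ).mulVec (expV v) = W.mulVec x + c ∧
  Real.sqrt μ • expV (-v) = A.mulVec x + b

/-- The divergence `h(u,v) := ⟨eᵘ, e^{−v}⟩ + ⟨e^{−u}, eᵛ⟩ − 2m`. -/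
noncomputable def diverg {m : ℕ} (u v : Fin m → ℝ) : ℝ :=
  (∑ i, Real.exp (u i) * Real.exp (-v i)) + (∑ i, Real.exp (-u i) * Real.exp (v i))
    - 2 * m

/-- The Euclidean norm of a vector in `ℝᵐ`. -/
noncomputable def enorm {m : ℕ} (d : Fin m → ℝ) : ℝ := Real.sqrt (∑ i, d i ^ 2)

/-- One-dimensional comparison argument. -/
theorem aux_descent (f df ddf : ℝ → ℝ) (hf : ∀ t, HasDerivAt f (df t) t)
    (hf' : ∀ t, HasDerivAt df (ddf t) t) (K D β T : ℝ) (hD : 0 ≤ D) (hK : 0 ≤ K)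
    (hpos : ∀ t, 0 ≤ ddf t) (hle : ∀ t, ddf t ≤ K * f t + 2 * D) (h0 : 0 < f 0)
    (h1 : df 0 ≤ -f 0 - D) (hT : 0 < T) (hT1 : T ≤ 1) (hTK : T * K ≤ 2 * β) (hβ : β < 1) :
    f T < f 0 := by
  by_contra hcon
  push Not at hcon
  have hcont : Continuous f := continuous_iff_continuousAt.2 fun t => (hf t).continuousAt
  have hderiv : deriv f = df := funext fun t => (hf t).deriv
  have hderiv' : deriv df = ddf := funext fun t => (hf' t).deriv
  have hmono' : Monotone df := monotone_of_deriv_nonneg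
    (fun t => (hf' t).differentiableAt) (fun t => by rw [hderiv']; exact hpos t)
  have hconv : ConvexOn ℝ Set.univ f := by
    apply MonotoneOn.convexOn_of_deriv convex_univ hcont.continuousOn
    · exact fun t _ => (hf t).differentiableAt.differentiableWithinAt
    · rw [hderiv]; exact hmono'.monotoneOn _

  have hneg : df 0 < 0 := by linarith
  obtain ⟨t1, ht1, ht1T, hft1⟩ : ∃ t1, 0 < t1 ∧ t1 < T ∧ f t1 < f 0 := by
    have hs := hasDerivAt_iff_tendsto_slope.1 (hf 0)
    have hs' : Filter.Tendsto (slope f 0) (nhdsWithin 0 (Set.Ioi 0)) (nhds (df 0)) :=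
      hs.mono_left (nhdsWithin_mono _ (fun y hy => ne_of_gt hy))
    have h2 := hs'.eventually (gt_mem_nhds hneg)
    have h3 : ∀ᶠ t in nhdsWithin (0:ℝ) (Set.Ioi 0), t ∈ Set.Ioo 0 T :=
      Ioo_mem_nhdsGT hT
    obtain ⟨t, h4, h5⟩ := (h2.and h3).exists
    refine ⟨t, h5.1, h5.2, ?_⟩
    rw [slope_def_field, sub_zero, div_neg_iff] at h4
    rcases h4 with h4 | h4
    · linarith [h5.1]
    · linarith
  obtain ⟨T0, ⟨hT0a, hT0b⟩, hfT0⟩ : f 0 ∈ f '' Set.Icc t1 T :=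
    intermediate_value_Icc ht1T.le hcont.continuousOn ⟨hft1.le, hcon⟩
  have hT0 : 0 < T0 := by linarith
  have hbd : ∀ t ∈ Set.Icc 0 T0, f t ≤ f 0 := by
    intro t ht
    have := hconv.le_max_of_mem_Icc (Set.mem_univ 0) (Set.mem_univ T0) ht
    rwa [hfT0, max_self] at this
  set C := K * f 0 + 2 * D with hC
  have hg' : MonotoneOn (fun t => t * C - df t) (Set.Icc 0 T0) := by
    have hd : ∀ t, HasDerivAt (fun t => t * C - df t) (1 * C - ddf t) t := fun t =>
      ((hasDerivAt_id t).mul_const C).sub (hf' t)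
    apply monotoneOn_of_deriv_nonneg (convex_Icc _ _)
    · exact fun t _ => (hd t).continuousAt.continuousWithinAt
    · exact fun t _ => (hd t).differentiableAt.differentiableWithinAt
    · intro t ht
      rw [(hd t).deriv]
      have := hle t
      have h6 := mul_le_mul_of_nonneg_left (hbd t (interior_subset ht)) hK
      linarith
  have hg : MonotoneOn (fun t => t * df 0 + t ^ 2 / 2 * C - f t) (Set.Icc 0 T0) := by
    have hd : ∀ t, HasDerivAt (fun t => t * df 0 + t ^ 2 / 2 * C - f t)
        (df 0 + t * C - df t) t := fun t => by
      have := ((((hasDerivAt_id t).mul_const (df 0)).add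
        ((((hasDerivAt_id t).pow 2).div_const 2).mul_const C)).sub (hf t))
      refine HasDerivAt.congr_deriv this ?_
      simp
    apply monotoneOn_of_deriv_nonneg (convex_Icc _ _)
    · exact fun t _ => (hd t).continuousAt.continuousWithinAt
    · exact fun t _ => (hd t).differentiableAt.differentiableWithinAt
    · intro t ht
      rw [(hd t).deriv]
      have ht' := interior_subset ht
      have := hg' ⟨le_rfl, hT0.le⟩ ht' ht'.1
      simp only at this
      linarith
  have h7 := hg ⟨le_rfl, hT0.le⟩ ⟨hT0.le, le_rfl⟩ hT0.le
  simp only [hfT0] at h7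
  have h8 : 0 ≤ T0 * (df 0 + T0 / 2 * C) := by nlinarith
  have h9 : 0 ≤ df 0 + T0 / 2 * C := nonneg_of_mul_nonneg_right h8 hT0
  have h10 : T0 * K ≤ T * K := mul_le_mul_of_nonneg_right hT0b hK
  have h11 : T0 * K * f 0 ≤ 2 * β * f 0 := mul_le_mul_of_nonneg_right (h10.trans hTK) h0.le
  have h12 : T0 * D ≤ 1 * D := mul_le_mul_of_nonneg_right (hT0b.trans hT1) hD
  have h13 : β * f 0 < 1 * f 0 := mul_lt_mul_of_pos_right hβ h0
  rw [hC] at h9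
  nlinarith

/-- The key inequality from the Newton and centering equations. -/
theorem aux_key {m n : ℕ} (A : Matrix (Fin m) (Fin n) ℝ) (b : Fin m → ℝ) (c : Fin n → ℝ)
    (W : Matrix (Fin n) (Fin n) ℝ) (hW : W.PosSemidef)
    (μ : ℝ) (hμ : 0 < μ) (vhat : Fin m → ℝ) (xhat : Fin n → ℝ)
    (hcent : IsCentered A b c W μ vhat xhat)
    (v d : Fin m → ℝ) (x : Fin n → ℝ) (hd : IsNewton A b c W μ v d x) :
    0 ≤ (expV v + expV v * d - expV vhat) ⬝ᵥ (expV (-v) - expV (-v) * d - expV (-vhat)) := by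
  obtain ⟨h1, h2⟩ := hcent
  obtain ⟨h3, h4⟩ := hd
  have e1 : Real.sqrt μ • (Aᵀ).mulVec (expV v + expV v * d - expV vhat)
      = W.mulVec (x - xhat) := by
    rw [Matrix.mulVec_sub, smul_sub, h3, h1, Matrix.mulVec_sub]; abel
  have e2 : Real.sqrt μ • (expV (-v) - expV (-v) * d - expV (-vhat))
      = A.mulVec (x - xhat) := by
    rw [smul_sub, h4, h2, Matrix.mulVec_sub]; abel
  set P := expV v + expV v * d - expV vhat
  set Q := expV (-v) - expV (-v) * d - expV (-vhat)
  have h5 : 0 ≤ (x - xhat) ⬝ᵥ W.mulVec (x - xhat) := by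
    simpa using hW.dotProduct_mulVec_nonneg (x - xhat)
  have hs : 0 < Real.sqrt μ := Real.sqrt_pos.2 hμ
  rw [← e1, dotProduct_smul, Matrix.mulVec_transpose, dotProduct_comm,
    ← Matrix.dotProduct_mulVec, ← e2, dotProduct_smul, smul_eq_mul, smul_eq_mul] at h5
  exact nonneg_of_mul_nonneg_right (nonneg_of_mul_nonneg_right h5 hs) hs

/-- if `v̂` is centered for `μ > 0`, `v ≠ v̂`, `d = d(v,μ) ≠ 0`,
`β ∈ (0,1)` and `α = max(1, ‖d‖∞²/(2β))`, then `f(1/α) < f(0)` where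
`f(t) := h(v̂, v + t·d)` (here `‖d‖` on `Fin m → ℝ` is the sup norm). -/
theorem stmt_6 {m n : ℕ} (A : Matrix (Fin m) (Fin n) ℝ) (b : Fin m → ℝ) (c : Fin n → ℝ)
    (W : Matrix (Fin n) (Fin n) ℝ) (hW : W.PosSemidef) (hAW : (Aᵀ * A + W).PosDef)
    (μ : ℝ) (hμ : 0 < μ) (vhat : Fin m → ℝ) (xhat : Fin n → ℝ)
    (hcent : IsCentered A b c W μ vhat xhat)
    (v d : Fin m → ℝ) (x : Fin n → ℝ) (hd : IsNewton A b c W μ v d x)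
    (hne : v ≠ vhat) (hdne : d ≠ 0)
    (β : ℝ) (hβ : β ∈ Set.Ioo (0 : ℝ) 1) :
    diverg vhat (v + (max 1 (‖d‖ ^ 2 / (2 * β)))⁻¹ • d) < diverg vhat v := by
  have hkey := aux_key A b c W hW μ hμ vhat xhat hcent v d x hd
  obtain ⟨hβ0, hβ1⟩ := hβ
  set α : ℝ := max 1 (‖d‖ ^ 2 / (2 * β)) with hα
  have hα1 : 1 ≤ α := le_max_left _ _
  have hα2 : ‖d‖ ^ 2 ≤ α * (2 * β) := by
    rw [← div_le_iff₀ (by positivity)]; exact le_max_right _ _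
  have hα0 : 0 < α := by linarith
  let g : Fin m → ℝ → ℝ := fun i t =>
    Real.exp (vhat i) * Real.exp (-(v i + t * d i)) + Real.exp (-vhat i) * Real.exp (v i + t * d i)
  let dg : Fin m → ℝ → ℝ := fun i t =>
    d i * (Real.exp (-vhat i) * Real.exp (v i + t * d i)
      - Real.exp (vhat i) * Real.exp (-(v i + t * d i)))
  let f : ℝ → ℝ := fun t => ∑ i, (g i t - 2)
  have hfeq : ∀ t, diverg vhat (v + t • d) = f t := by
    intro t
    simp only [diverg, f, g, Finset.sum_sub_distrib, Finset.sum_add_distrib]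
    simp
    ring
  have hlin : ∀ i t, HasDerivAt (fun t : ℝ => v i + t * d i) (d i) t := fun i t => by
    simpa using ((hasDerivAt_id t).mul_const (d i)).const_add (v i)
  have hg : ∀ i t, HasDerivAt (g i) (dg i t) t := fun i t => by
    have := (((hlin i t).neg.exp).const_mul (Real.exp (vhat i))).add
      (((hlin i t).exp).const_mul (Real.exp (-vhat i)))
    refine HasDerivAt.congr_deriv this ?_
    simp only [dg, Pi.neg_apply]
    ring
  have hg' : ∀ i t, HasDerivAt (dg i) (d i ^ 2 * g i t) t := fun i t => by
    have := ((((hlin i t).exp).const_mul (Real.exp (-vhat i))).sub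
      (((hlin i t).neg.exp).const_mul (Real.exp (vhat i)))).const_mul (d i)
    refine HasDerivAt.congr_deriv this ?_
    simp only [g, Pi.neg_apply]
    ring
  have hcosh : ∀ i t, g i t = Real.exp (v i + t * d i - vhat i)
      + Real.exp (-(v i + t * d i - vhat i)) := fun i t => by
    simp only [g, ← Real.exp_add]
    rw [add_comm]
    congr 2 <;> ring
  have hg2 : ∀ i t, 2 ≤ g i t := fun i t => by
    rw [hcosh]
    have := Real.one_le_cosh (v i + t * d i - vhat i)
    rw [Real.cosh_eq] at this
    linarith
  have h0 : 0 < f 0 := by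
    obtain ⟨j, hj⟩ := Function.ne_iff.1 hne
    apply Finset.sum_pos' (fun i _ => by linarith [hg2 i 0])
    refine ⟨j, Finset.mem_univ _, ?_⟩
    rw [hcosh]
    have hj' : v j + 0 * d j - vhat j ≠ 0 := by
      rw [zero_mul, add_zero]; exact sub_ne_zero.2 hj
    have := Real.one_lt_cosh.2 hj'
    rw [Real.cosh_eq] at this
    linarith
  have hmain := aux_descent f (fun t => ∑ i, dg i t) (fun t => ∑ i, d i ^ 2 * g i t)
    (fun t => HasDerivAt.fun_sum fun i _ => (hg i t).sub_const 2)
    (fun t => HasDerivAt.fun_sum fun i _ => hg' i t)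
    (‖d‖ ^ 2) (∑ i, d i ^ 2) β α⁻¹ (Finset.sum_nonneg fun i _ => sq_nonneg _) (sq_nonneg _)
    (fun t => Finset.sum_nonneg fun i _ => mul_nonneg (sq_nonneg _) (by linarith [hg2 i t]))
    ?_ h0 ?_ (inv_pos.2 hα0) (inv_le_one_of_one_le₀ hα1) ?_ hβ1
  · rw [hfeq, ← zero_add α⁻¹, zero_add]
    have := hfeq 0
    rw [zero_smul, add_zero] at this
    rwa [this]
  · intro t
    simp only [f]
    rw [Finset.mul_sum, Finset.mul_sum, ← Finset.sum_add_distrib]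
    apply Finset.sum_le_sum
    intro i _
    have h1 : d i ^ 2 ≤ ‖d‖ ^ 2 := by
      rw [← sq_abs (d i)]
      exact pow_le_pow_left₀ (abs_nonneg _) (norm_le_pi_norm d i) 2
    have := hg2 i t
    nlinarith [mul_le_mul_of_nonneg_right h1 (sub_nonneg.2 this)]
  · simp only [f]
    have : (expV v + expV v * d - expV vhat) ⬝ᵥ (expV (-v) - expV (-v) * d - expV (-vhat))
        = -(∑ i, (g i 0 - 2)) - (∑ i, d i ^ 2) - ∑ i, dg i 0 := by
      rw [← Finset.sum_neg_distrib, ← Finset.sum_sub_distrib, ← Finset.sum_sub_distrib]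
      apply Finset.sum_congr rfl
      intro i _
      have e1 : Real.exp (v i) * Real.exp (-v i) = 1 := by rw [← Real.exp_add]; simp
      have e2 : Real.exp (vhat i) * Real.exp (-vhat i) = 1 := by rw [← Real.exp_add]; simp
      simp only [g, dg, expV, Pi.add_apply, Pi.sub_apply, Pi.mul_apply, Pi.neg_apply, zero_mul,
        add_zero]
      linear_combination (1 - d i ^ 2) * e1 + e2
    linarith
  · rw [inv_mul_le_iff₀ hα0]; exact hα2
end

section
/- Fix β ∈ (0,1) and μ > 0 and suppose a centered point v̂(μ) exists (some v̂, x̂ satisfy √μ·Aᵀe^{v̂} = Wx̂ + c and √μ·e^{−v̂} = Ax̂ + b). For any initial v₀ ∈ ℝᵐ, the Newton iterations v_{i+1} = v_i + (1/αᵢ)·d(vᵢ, μ) with step-size rule αᵢ = max(1, ‖d(vᵢ,μ)‖∞²/(2β)) converge to v̂(μ). -/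
open Matrix

open Filter Topology

lemma aux_fact_c (n : ℕ) : (24 * 10 ^ n : ℝ) ≤ ((2 * (n + 2)).factorial : ℝ) := by
  induction n with
  | zero => norm_num [Nat.factorial]
  | succ k ih =>
    have h : (2 * (k + 1 + 2)) = (2 * (k + 2)) + 1 + 1 := by ring
    rw [h, Nat.factorial_succ, Nat.factorial_succ]
    push_cast
    have hk : (0 : ℝ) ≤ k := Nat.cast_nonneg k
    have h2 : (10 : ℝ) ≤ (2 * (k + 2) + 1 + 1) * (2 * (k + 2) + 1) := by nlinarith
    have h3 : (0 : ℝ) ≤ 24 * 10 ^ k := by positivity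
    calc (24 * 10 ^ (k + 1) : ℝ) = 10 * (24 * 10 ^ k) := by ring
      _ ≤ ((2 * (k + 2) + 1 + 1) * (2 * (k + 2) + 1)) * ((2 * (k + 2)).factorial : ℝ) := by
        apply mul_le_mul h2 ih h3; positivity
      _ = _ := by ring

lemma aux_fact_s (n : ℕ) : (6 * 20 ^ n : ℝ) ≤ ((2 * (n + 1) + 1).factorial : ℝ) := by
  induction n with
  | zero => norm_num [Nat.factorial]
  | succ k ih =>
    have h : (2 * (k + 1 + 1) + 1) = (2 * (k + 1) + 1) + 1 + 1 := by ring
    rw [h, Nat.factorial_succ, Nat.factorial_succ]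
    push_cast
    have hk : (0 : ℝ) ≤ k := Nat.cast_nonneg k
    have h2 : (20 : ℝ) ≤ (2 * (k + 1) + 1 + 1 + 1) * (2 * (k + 1) + 1 + 1) := by nlinarith
    have h3 : (0 : ℝ) ≤ 6 * 20 ^ k := by positivity
    calc (6 * 20 ^ (k + 1) : ℝ) = 20 * (6 * 20 ^ k) := by ring
      _ ≤ ((2 * (k + 1) + 1 + 1 + 1) * (2 * (k + 1) + 1 + 1)) *
          ((2 * (k + 1) + 1).factorial : ℝ) := by
        apply mul_le_mul h2 ih h3; positivity
      _ = _ := by ring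

lemma aux_cosh_lower (u : ℝ) : 1 + u ^ 2 / 2 ≤ Real.cosh u := by
  have h := sum_le_hasSum (Finset.range 2) (fun n _ => by
    have : u ^ (2 * n) = (u ^ n) ^ 2 := by ring
    rw [this]; positivity) (Real.hasSum_cosh u)
  norm_num [Finset.sum_range_succ, Nat.factorial] at h
  linarith

lemma aux_sinh_lower (u : ℝ) (hu : 0 ≤ u) : u + u ^ 3 / 6 ≤ Real.sinh u := by
  have h := sum_le_hasSum (Finset.range 2) (fun n _ => by positivity) (Real.hasSum_sinh u)
  norm_num [Finset.sum_range_succ, Nat.factorial] at h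
  linarith

lemma aux_cosh_upper (u : ℝ) (hu : u ^ 2 ≤ 2) :
    Real.cosh u ≤ 1 + u ^ 2 / 2 + 5 * u ^ 4 / 96 := by
  have h := (hasSum_nat_add_iff' 2).mpr (Real.hasSum_cosh u)
  have hlt : u ^ 2 / 10 < 1 := by linarith
  have hg := (hasSum_geometric_of_lt_one (by positivity : (0:ℝ) ≤ u ^ 2 / 10) hlt).mul_left
    (u ^ 4 / 24)
  have hle := hasSum_le (fun n => ?_) h hg
  · norm_num [Finset.sum_range_succ, Nat.factorial] at hle
    have : (1 - u ^ 2 / 10)⁻¹ ≤ 5 / 4 := by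
      rw [inv_le_comm₀ (by linarith) (by norm_num)]; linarith
    have h4 : 0 ≤ u ^ 4 / 24 := by positivity
    nlinarith [mul_le_mul_of_nonneg_left this h4]
  · have h1 : u ^ 4 / 24 * (u ^ 2 / 10) ^ n = u ^ (2 * (n + 2)) / (24 * 10 ^ n) := by
      rw [div_pow, div_mul_div_comm]; congr 1; ring
    rw [h1]
    have : u ^ (2 * (n + 2)) = (u ^ (n + 2)) ^ 2 := by ring
    apply div_le_div_of_nonneg_left _ (by positivity) (aux_fact_c n)
    rw [this]; positivity

lemma aux_sinh_upper (u : ℝ) (h0 : 0 ≤ u) (hu : u ^ 2 ≤ 2) :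
    Real.sinh u ≤ u + u ^ 3 / 6 * (1 + u ^ 2 / 8) := by
  have h := (hasSum_nat_add_iff' 1).mpr (Real.hasSum_sinh u)
  have hlt : u ^ 2 / 20 < 1 := by linarith
  have hg := (hasSum_geometric_of_lt_one (by positivity : (0:ℝ) ≤ u ^ 2 / 20) hlt).mul_left
    (u ^ 3 / 6)
  have hle := hasSum_le (fun n => ?_) h hg
  · norm_num [Finset.sum_range_succ, Nat.factorial] at hle
    have : (1 - u ^ 2 / 20)⁻¹ ≤ 1 + u ^ 2 / 8 := by
      rw [inv_le_iff_one_le_mul₀ (by linarith)]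
      nlinarith [sq_nonneg u]
    have h4 : 0 ≤ u ^ 3 / 6 := by positivity
    nlinarith [mul_le_mul_of_nonneg_left this h4]
  · have h1 : u ^ 3 / 6 * (u ^ 2 / 20) ^ n = u ^ (2 * (n + 1) + 1) / (6 * 20 ^ n) := by
      rw [div_pow, div_mul_div_comm]; congr 1; ring
    rw [h1]
    exact div_le_div_of_nonneg_left (by positivity) (by positivity) (aux_fact_s n)

/-- The polynomial inequality behind the decrease. -/
lemma aux_poly (y ρ : ℝ) (hy0 : 0 ≤ y) (hy : y ≤ 2) (h0 : 0 ≤ ρ) (h1 : ρ ≤ 1) :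
    16 * (1 + y / 8 - ρ) ^ 2 ≤
      (12 * (1 - ρ) + y * (2 - 5 / 4 * ρ ^ 2)) * (2 - 5 / 4 * ρ) := by
  obtain ⟨τ, rfl⟩ : ∃ τ, ρ = 1 - τ := ⟨1 - ρ, by ring⟩
  have ht0 : 0 ≤ τ := by linarith
  have ht1 : τ ≤ 1 := by linarith
  have hA : 12 * τ + y * (3 / 4) ≤ 12 * (1 - (1 - τ)) + y * (2 - 5 / 4 * (1 - τ) ^ 2) := by
    nlinarith [mul_nonneg hy0 (mul_nonneg ht0 (by linarith : 0 ≤ 2 - τ))]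
  have hB : 0 ≤ 2 - 5 / 4 * (1 - τ) := by linarith
  refine le_trans ?_ (mul_le_mul_of_nonneg_right hA hB)
  nlinarith [mul_nonneg ht0 hy0, mul_nonneg ht0 (by linarith : 0 ≤ 1 - τ),
    mul_nonneg hy0 (by linarith : 0 ≤ 2 - y), mul_nonneg ht0 (by linarith : 0 ≤ 2 - y)]

lemma aux_quad (X Y Q C S : ℝ) (hQ : 0 ≤ Q) (hXQ : Q ≤ X) (hY : 0 ≤ Y) (hXY : Q ^ 2 ≤ X * Y)
    (hC : 0 ≤ C) (hS : S ^ 2 = C ^ 2 + 2 * C) : Q * S ≤ X * C + Y := by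
  apply le_of_sq_le_sq _ (by have := hQ.trans hXQ; positivity)
  have h1 : Q ^ 2 ≤ X ^ 2 := by nlinarith
  have : (Q * S) ^ 2 = Q ^ 2 * C ^ 2 + 2 * Q ^ 2 * C := by rw [mul_pow, hS]; ring
  rw [this]
  nlinarith [mul_le_mul_of_nonneg_right h1 (sq_nonneg C), mul_le_mul_of_nonneg_right hXY hC,
    sq_nonneg Y]

set_option maxHeartbeats 1000000 in
lemma aux_key_s8 (U r e : ℝ) (hU : 0 ≤ U) (hU2 : U ^ 2 ≤ 2) (h0 : 0 ≤ r) (h1 : r ≤ 1) :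
    Real.cosh e * (Real.cosh (r * U) - 1) + Real.sinh e * (r * Real.sinh U - Real.sinh (r * U))
      ≤ r ^ 2 * (U ^ 2 / 2 + U ^ 4 / 12) + (U ^ 2 / 2 + U ^ 4 / 12) * (Real.cosh e - 1) := by
  have hr2 : r ^ 2 ≤ 1 := by nlinarith
  have hru : (r * U) ^ 2 ≤ 2 := by
    rw [mul_pow]; nlinarith [sq_nonneg U, sq_nonneg r]
  have hruU : 0 ≤ r * U := mul_nonneg h0 hU
  have hp := aux_cosh_upper (r * U) hru
  have hs1 := mul_le_mul_of_nonneg_left (aux_sinh_upper U hU hU2) h0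
  have hs2 := mul_le_mul_of_nonneg_left (aux_sinh_lower U hU) h0
  have hs3 := aux_sinh_upper (r * U) hruU hru
  have hs4 := aux_sinh_lower (r * U) hruU
  set C := Real.cosh e - 1 with hCdef
  have hC : 0 ≤ C := by have := Real.one_le_cosh e; linarith
  have hS : |Real.sinh e| ^ 2 = C ^ 2 + 2 * C := by
    rw [sq_abs]; have := Real.cosh_sq e; rw [hCdef]; nlinarith
  set P := r ^ 2 * U ^ 2 / 2 + 5 * r ^ 4 * U ^ 4 / 96 with hP
  set Q := r * U ^ 3 / 6 * (1 + U ^ 2 / 8 - r ^ 2) with hQ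
  set K := U ^ 2 / 2 + U ^ 4 / 12 with hK
  have hU3 : 0 ≤ r * U ^ 3 := by positivity
  have hQ0 : 0 ≤ Q := by
    apply mul_nonneg (by positivity); nlinarith [sq_nonneg U]
  have hqQ : |r * Real.sinh U - Real.sinh (r * U)| ≤ Q := by
    rw [abs_le]
    constructor
    · have : 0 ≤ r * U ^ 3 / 6 * (2 * (1 - r ^ 2) + U ^ 2 / 8 * (1 - (r ^ 2) ^ 2)) := by
        apply mul_nonneg (by positivity)
        have : 0 ≤ 1 - (r ^ 2) ^ 2 := by nlinarith [sq_nonneg r]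
        have : 0 ≤ U ^ 2 / 8 * (1 - (r ^ 2) ^ 2) := by positivity
        linarith
      rw [hQ]; nlinarith
    · rw [hQ]; nlinarith
  have hy0 : 0 ≤ U ^ 2 := sq_nonneg U
  have hρ0 : 0 ≤ r ^ 2 := sq_nonneg r
  have hXY : Q ^ 2 ≤ (K - P) * (r ^ 2 * K - P) := by
    have h := mul_le_mul_of_nonneg_left (aux_poly (U ^ 2) (r ^ 2) hy0 hU2 hρ0 hr2)
      (by positivity : 0 ≤ r ^ 2 * U ^ 6 / 576)
    have e1 : Q ^ 2 = r ^ 2 * U ^ 6 / 576 * (16 * (1 + U ^ 2 / 8 - r ^ 2) ^ 2) := by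
      rw [hQ]; ring
    have e2 : (K - P) * (r ^ 2 * K - P) = r ^ 2 * U ^ 6 / 576 *
      ((12 * (1 - r ^ 2) + U ^ 2 * (2 - 5 / 4 * (r ^ 2) ^ 2)) * (2 - 5 / 4 * r ^ 2)) := by
      rw [hK, hP]; ring
    rw [e1, e2]; exact h
  have hY : 0 ≤ r ^ 2 * K - P := by
    have : r ^ 2 * K - P = r ^ 2 * U ^ 4 / 24 * (2 - 5 / 4 * r ^ 2) := by rw [hK, hP]; ring
    rw [this]; apply mul_nonneg (by positivity); linarith
  have hXQ : Q ≤ K - P := by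
    have hb : r * U ≤ 3 / 2 := by nlinarith
    have e1 : Q = (r * U) * (U ^ 2 / 6 * (1 + U ^ 2 / 8 - r ^ 2)) := by rw [hQ]; ring
    have h2 : 0 ≤ U ^ 2 / 6 * (1 + U ^ 2 / 8 - r ^ 2) := by
      apply mul_nonneg (by positivity); linarith
    have h3 := mul_le_mul_of_nonneg_right hb h2
    have hρ2 : (r ^ 2) ^ 2 ≤ 1 := pow_le_one₀ hρ0 hr2
    rw [e1, hK, hP]
    have g1 := mul_nonneg hy0 (sub_nonneg.2 hr2)
    have g2 := mul_nonneg (mul_nonneg hy0 hy0) (sub_nonneg.2 hρ2)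
    refine le_trans h3 ?_
    linarith
  have hmain := aux_quad (K - P) (r ^ 2 * K - P) Q C |Real.sinh e| hQ0 hXQ hY hXY hC hS
  have hqs : Real.sinh e * (r * Real.sinh U - Real.sinh (r * U)) ≤ Q * |Real.sinh e| := by
    refine (le_abs_self _).trans ?_
    rw [abs_mul, mul_comm]
    exact mul_le_mul_of_nonneg_right hqQ (abs_nonneg _)
  have hpp : Real.cosh (r * U) - 1 ≤ P := by rw [hP]; nlinarith
  have hce : Real.cosh e = 1 + C := by rw [hCdef]; ring
  rw [hce]
  nlinarith [mul_le_mul_of_nonneg_left hpp (by linarith : 0 ≤ 1 + C)]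

/-- per-coordinate decrease -/
lemma aux_coord (β D t d e : ℝ) (hβ0 : 0 < β) (hD : 0 < D) (ht0 : 0 < t) (ht1 : t ≤ 1)
    (htD : t * D ^ 2 ≤ 2 * β) (hβ1 : β ≤ 1) (hd : |d| ≤ D) :
    Real.cosh (e - t * d) - 1 + Real.sinh (t * D) / (2 * D) *
      (2 * d * Real.sinh e - d ^ 2 - 2 * (Real.cosh e - 1)) ≤
    (1 - (1 - β) * (Real.sinh (t * D) / D)) * (Real.cosh e - 1) := by
  wlog hd0 : 0 ≤ d generalizing d e
  · have := this (-d) (-e) (by rwa [abs_neg]) (by linarith)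
    rw [Real.sinh_neg, Real.cosh_neg, show -e - t * -d = -(e - t * d) by ring,
      Real.cosh_neg] at this
    convert this using 3
    ring
  have hU : 0 ≤ t * D := by positivity
  have hUD : t * D ≤ D := by nlinarith
  have hU2 : (t * D) ^ 2 ≤ 2 := by nlinarith [sq_nonneg D, mul_pos ht0 (pow_pos hD 2)]
  obtain ⟨r, rfl⟩ : ∃ r, d = r * D := ⟨d / D, by field_simp⟩
  have hr0 : 0 ≤ r := by
    by_contra h; push Not at h; nlinarith
  have hr1 : r ≤ 1 := by
    rw [abs_of_nonneg hd0] at hd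
    by_contra h; push Not at h; nlinarith
  have hk := aux_key_s8 (t * D) r e hU hU2 hr0 hr1
  have hs := aux_sinh_lower (t * D) hU
  set s := Real.sinh (t * D)
  set U := t * D
  have hs0 : 0 ≤ s := by have : 0 ≤ U + U ^ 3 / 6 := by positivity
                         linarith
  have hK : U ^ 2 / 2 + U ^ 4 / 12 ≤ s * U / 2 := by nlinarith [mul_le_mul_of_nonneg_right hs hU]
  have hK1 : U ^ 2 / 2 + U ^ 4 / 12 ≤ s * D / 2 := by nlinarith
  have hK2 : U ^ 2 / 2 + U ^ 4 / 12 ≤ β * (s / D) := by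
    refine hK.trans ?_
    rw [mul_div_assoc', le_div_iff₀ hD]
    have : U * D ≤ 2 * β := by simpa [U, pow_two, mul_assoc] using htD
    nlinarith
  have hC : 0 ≤ Real.cosh e - 1 := by have := Real.one_le_cosh e; linarith
  have h1 := mul_le_mul_of_nonneg_left hK1 (sq_nonneg r)
  have h2 := mul_le_mul_of_nonneg_right hK2 hC
  have e0 : t * (r * D) = r * U := by simp only [U]; ring
  rw [e0, Real.cosh_sub]
  have e1 : s / (2 * D) * (2 * (r * D) * Real.sinh e - (r * D) ^ 2 - 2 * (Real.cosh e - 1))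
      = r * s * Real.sinh e - r ^ 2 * (s * D / 2) - s / D * (Real.cosh e - 1) := by
    field_simp
  rw [e1]
  nlinarith

/-- the basic inequality from the Newton system -/
lemma aux_newton {m n : ℕ} (A : Matrix (Fin m) (Fin n) ℝ) (b : Fin m → ℝ) (c : Fin n → ℝ)
    (W : Matrix (Fin n) (Fin n) ℝ) (hW : W.PosSemidef) (μ : ℝ) (hμ : 0 < μ)
    (vhat : Fin m → ℝ) (xhat : Fin n → ℝ) (hcent : IsCentered A b c W μ vhat xhat)
    (v d : Fin m → ℝ) (x : Fin n → ℝ) (hN : IsNewton A b c W μ v d x) :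
    0 ≤ ∑ i, (2 * d i * Real.sinh (vhat i - v i) - d i ^ 2
      - 2 * (Real.cosh (vhat i - v i) - 1)) := by
  obtain ⟨c1, c2⟩ := hcent
  obtain ⟨n1, n2⟩ := hN
  set p := expV v + expV v * d - expV vhat with hp
  set q := expV (-v) - expV (-v) * d - expV (-vhat) with hq
  set s := Real.sqrt μ with hs
  have hs0 : 0 < s := Real.sqrt_pos.2 hμ
  have h1 : s • (Aᵀ).mulVec p = W.mulVec (x - xhat) := by
    rw [hp, Matrix.mulVec_sub, smul_sub, n1, c1, Matrix.mulVec_sub]; abel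
  have h2 : s • q = A.mulVec (x - xhat) := by
    rw [hq, smul_sub, n2, c2, Matrix.mulVec_sub]; abel
  have h3 : 0 ≤ (x - xhat) ⬝ᵥ W.mulVec (x - xhat) := by
    simpa using hW.dotProduct_mulVec_nonneg (x - xhat)
  rw [← h1, dotProduct_smul, Matrix.dotProduct_mulVec, Matrix.vecMul_transpose, ← h2,
    smul_dotProduct, smul_eq_mul, smul_eq_mul, ← mul_assoc] at h3
  have h4 : 0 ≤ q ⬝ᵥ p := by
    by_contra h; push Not at h
    nlinarith [mul_pos hs0 hs0]
  have h5 : q ⬝ᵥ p = ∑ i, (2 * d i * Real.sinh (vhat i - v i) - d i ^ 2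
      - 2 * (Real.cosh (vhat i - v i) - 1)) := by
    unfold dotProduct
    apply Finset.sum_congr rfl
    intro i _
    simp only [hp, hq, expV, Pi.add_apply, Pi.sub_apply, Pi.mul_apply, Pi.neg_apply]
    rw [Real.sinh_eq, Real.cosh_eq, neg_sub, Real.exp_sub, Real.exp_sub, Real.exp_neg,
      Real.exp_neg]
    field_simp
    ring
  linarith

/-- fix `β ∈ (0,1)`, `μ > 0` and a centered point `v̂(μ)`. For any
initialization `v₀`, the Newton iterations `v_{i+1} = v_i + (1/αᵢ)·d(vᵢ,μ)` with
`αᵢ = max(1, ‖d(vᵢ,μ)‖∞²/(2β))` converge to `v̂(μ)`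
(here `‖·‖` on `Fin m → ℝ` is the sup norm). -/
theorem stmt_8 {m n : ℕ} (A : Matrix (Fin m) (Fin n) ℝ) (b : Fin m → ℝ) (c : Fin n → ℝ)
    (W : Matrix (Fin n) (Fin n) ℝ) (hW : W.PosSemidef) (hAW : (Aᵀ * A + W).PosDef)
    (β : ℝ) (hβ : β ∈ Set.Ioo (0 : ℝ) 1) (μ : ℝ) (hμ : 0 < μ)
    (vhat : Fin m → ℝ) (xhat : Fin n → ℝ) (hcent : IsCentered A b c W μ vhat xhat)
    (v : ℕ → Fin m → ℝ) (d : ℕ → Fin m → ℝ) (x : ℕ → Fin n → ℝ)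
    (hnewton : ∀ i, IsNewton A b c W μ (v i) (d i) (x i))
    (hrec : ∀ i, v (i + 1) = v i + (max 1 (‖d i‖ ^ 2 / (2 * β)))⁻¹ • d i) :
    Filter.Tendsto v Filter.atTop (nhds vhat) := by
  obtain ⟨hβ0, hβ1⟩ := hβ
  set H : ℕ → ℝ := fun k => ∑ i, (Real.cosh (vhat i - v k i) - 1) with hH
  have hterm : ∀ k i, 0 ≤ Real.cosh (vhat i - v k i) - 1 := fun k i => by
    have := Real.one_le_cosh (vhat i - v k i); linarith
  have hH0 : ∀ k, 0 ≤ H k := fun k => Finset.sum_nonneg fun i _ => hterm k i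
  have hHi : ∀ k i, Real.cosh (vhat i - v k i) - 1 ≤ H k := fun k i =>
    Finset.single_le_sum (f := fun i => Real.cosh (vhat i - v k i) - 1)
      (fun j _ => hterm k j) (Finset.mem_univ i)
  have hbas := fun k => aux_newton A b c W hW μ hμ vhat xhat hcent _ _ _ (hnewton k)
  set t : ℕ → ℝ := fun k => (max 1 (‖d k‖ ^ 2 / (2 * β)))⁻¹ with ht
  have htpos : ∀ k, 0 < t k := fun k => inv_pos.2 (lt_of_lt_of_le one_pos (le_max_left _ _))
  have ht1 : ∀ k, t k ≤ 1 := fun k => inv_le_one_of_one_le₀ (le_max_left _ _)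
  have htD : ∀ k, t k * ‖d k‖ ^ 2 ≤ 2 * β := fun k => by
    have h1 : ‖d k‖ ^ 2 ≤ 2 * β * max 1 (‖d k‖ ^ 2 / (2 * β)) := by
      have := le_max_right 1 (‖d k‖ ^ 2 / (2 * β))
      rw [div_le_iff₀ (by positivity)] at this
      linarith
    rw [ht]
    have hm : 0 < max 1 (‖d k‖ ^ 2 / (2 * β)) := lt_of_lt_of_le one_pos (le_max_left _ _)
    simp only
    rw [inv_mul_le_iff₀ hm]
    linarith
  -- decrease
  have hdec : ∀ k, H (k + 1) ≤ (1 - (1 - β) * t k) * H k := by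
    intro k
    have hv : ∀ i, vhat i - v (k + 1) i = (vhat i - v k i) - t k * d k i := fun i => by
      rw [hrec k]; simp only [Pi.add_apply, Pi.smul_apply, smul_eq_mul, ht]; ring
    rcases (norm_nonneg (d k)).eq_or_lt with hD | hD
    · have hd0 : d k = 0 := norm_eq_zero.1 hD.symm
      have hb := hbas k
      simp only [hd0, Pi.zero_apply] at hb
      have hz : H k ≤ 0 := by
        have : ∑ i, (2 * 0 * Real.sinh (vhat i - v k i) - 0 ^ 2
          - 2 * (Real.cosh (vhat i - v k i) - 1)) = -2 * H k := by
          rw [hH, Finset.mul_sum]; apply Finset.sum_congr rfl; intro i _; ring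
        linarith
      have hz' : H k = 0 := le_antisymm hz (hH0 k)
      have : H (k + 1) = H k := by
        simp only [hH]; apply Finset.sum_congr rfl; intro i _
        rw [hv, hd0]; simp
      rw [this, hz']; simp
    · have hc : ∀ i, _ := fun i => aux_coord β ‖d k‖ (t k) (d k i) (vhat i - v k i) hβ0 hD
        (htpos k) (ht1 k) (htD k) hβ1.le (by simpa using norm_le_pi_norm (d k) i)
      have hs := Finset.sum_le_sum (s := Finset.univ) fun i _ => hc i
      rw [Finset.sum_add_distrib, ← Finset.mul_sum, ← Finset.mul_sum] at hs
      have hl := aux_sinh_lower (t k * ‖d k‖) (mul_nonneg (htpos k).le hD.le)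
      have hl2 : t k ≤ Real.sinh (t k * ‖d k‖) / ‖d k‖ := by
        rw [le_div_iff₀ hD]
        have : 0 ≤ (t k * ‖d k‖) ^ 3 / 6 := by have := htpos k; positivity
        linarith
      have hk0 : 0 ≤ Real.sinh (t k * ‖d k‖) / (2 * ‖d k‖) := by
        apply div_nonneg _ (by positivity)
        rw [Real.sinh_nonneg_iff]; exact mul_nonneg (htpos k).le hD.le
      have h1 := mul_nonneg hk0 (hbas k)
      have h2 : H (k + 1) = ∑ i, (Real.cosh ((vhat i - v k i) - t k * d k i) - 1) := by
        simp only [hH, hv]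
      have h3 : (1 - (1 - β) * (Real.sinh (t k * ‖d k‖) / ‖d k‖)) * H k
          ≤ (1 - (1 - β) * t k) * H k := by
        apply mul_le_mul_of_nonneg_right _ (hH0 k)
        have := mul_le_mul_of_nonneg_left hl2 (by linarith : 0 ≤ 1 - β)
        linarith
      refine le_trans ?_ h3
      rw [h2]
      simp only [hH]
      linarith
  have hmono : ∀ k, H k ≤ H 0 := by
    intro k
    induction k with
    | zero => exact le_rfl
    | succ k ih =>
      refine le_trans (hdec k) (le_trans ?_ ih)
      have := mul_nonneg (mul_nonneg (by linarith : 0 ≤ 1 - β) (htpos k).le) (hH0 k)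
      linarith
  -- bound on the directions
  set M : ℝ := 4 * (m * (H 0 ^ 2 + 2 * H 0)) with hM
  have hM0 : 0 ≤ M := by have := hH0 0; positivity
  have hDb : ∀ k, ‖d k‖ ^ 2 ≤ M := by
    intro k
    have hsin : ∀ i, Real.sinh (vhat i - v k i) ^ 2 ≤ H 0 ^ 2 + 2 * H 0 := fun i => by
      have h1 := Real.cosh_sq (vhat i - v k i)
      have h2 := (hHi k i).trans (hmono k)
      have h3 := hterm k i
      nlinarith
    have hsum : ∑ i, d k i ^ 2 ≤ M := by
      have h1 : ∑ i, (2 * d k i * Real.sinh (vhat i - v k i) - d k i ^ 2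
          - 2 * (Real.cosh (vhat i - v k i) - 1)) ≤
          ∑ i : Fin m, (2 * (H 0 ^ 2 + 2 * H 0) - (1 / 2) * d k i ^ 2) := by
        apply Finset.sum_le_sum
        intro i _
        nlinarith [hsin i, hterm k i, sq_nonneg (d k i - 2 * Real.sinh (vhat i - v k i))]
      replace h1 := (hbas k).trans h1
      rw [Finset.sum_sub_distrib, ← Finset.mul_sum, ← Finset.mul_sum, Finset.sum_const, Finset.card_univ,
        Fintype.card_fin, nsmul_eq_mul] at h1
      rw [hM]
      linarith
    have hn : ‖d k‖ ≤ Real.sqrt M := by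
      rw [pi_norm_le_iff_of_nonneg (Real.sqrt_nonneg _)]
      intro i
      rw [Real.norm_eq_abs]
      apply Real.abs_le_sqrt
      exact (Finset.single_le_sum (f := fun i => d k i ^ 2) (fun j _ => sq_nonneg _)
        (Finset.mem_univ i)).trans hsum
    calc ‖d k‖ ^ 2 ≤ Real.sqrt M ^ 2 := pow_le_pow_left₀ (norm_nonneg _) hn 2
      _ = M := Real.sq_sqrt hM0
  set τ : ℝ := (max 1 (M / (2 * β)))⁻¹ with hτ
  have hτ0 : 0 < τ := inv_pos.2 (lt_of_lt_of_le one_pos (le_max_left _ _))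
  have hτ1 : τ ≤ 1 := inv_le_one_of_one_le₀ (le_max_left _ _)
  have hτt : ∀ k, τ ≤ t k := fun k => by
    apply inv_anti₀ (lt_of_lt_of_le one_pos (le_max_left _ _))
    apply max_le_max le_rfl
    exact div_le_div_of_nonneg_right (hDb k) (by positivity)
  have hθ0 : 0 ≤ 1 - (1 - β) * τ := by nlinarith
  have hθ1 : 1 - (1 - β) * τ < 1 := by nlinarith [mul_pos (by linarith : 0 < 1 - β) hτ0]
  have hgeo : ∀ k, H k ≤ (1 - (1 - β) * τ) ^ k * H 0 := by
    intro k
    induction k with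
    | zero => simp
    | succ k ih =>
      calc H (k + 1) ≤ (1 - (1 - β) * t k) * H k := hdec k
        _ ≤ (1 - (1 - β) * τ) * H k := by
          apply mul_le_mul_of_nonneg_right _ (hH0 k)
          have := mul_le_mul_of_nonneg_left (hτt k) (by linarith : 0 ≤ 1 - β)
          linarith
        _ ≤ (1 - (1 - β) * τ) * ((1 - (1 - β) * τ) ^ k * H 0) :=
          mul_le_mul_of_nonneg_left ih hθ0
        _ = _ := by ring
  have hlim : Tendsto H atTop (𝓝 0) := by
    apply squeeze_zero hH0 hgeo
    simpa using (tendsto_pow_atTop_nhds_zero_of_lt_one hθ0 hθ1).mul_const (H 0)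
  rw [tendsto_pi_nhds]
  intro i
  rw [tendsto_iff_dist_tendsto_zero]
  have hlim2 : Tendsto (fun k => Real.sqrt (2 * H k)) atTop (𝓝 0) := by
    have h := (Real.continuous_sqrt.tendsto (2 * 0)).comp (hlim.const_mul 2)
    rw [mul_zero, Real.sqrt_zero] at h
    exact h
  refine squeeze_zero (fun k => dist_nonneg) (fun k => ?_) hlim2
  rw [Real.dist_eq]
  apply Real.abs_le_sqrt
  have h1 := aux_cosh_lower (vhat i - v k i)
  have h2 := hHi k i
  nlinarith
end

section
/- Fix μ > 0 and suppose a centered point v̂(μ) exists. Let v₀ ∈ ℝᵐ and define the full-Newton-step iterates v_{i+1} = v_i + d(v_i, μ). If h(v̂(μ), v₀) ≤ θ for some θ ≤ 1/2, then for all i ≥ 0, h(v̂(μ), v_i) ≤ θ^(2^i). -/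
open Matrix

theorem sinh_sub_bound (t : ℝ) : (Real.sinh t - t) ^ 2 ≤ t ^ 2 * (Real.cosh t - 1) ^ 2 := by
  have key : ∀ s : ℝ, 0 ≤ s → Real.sinh s ≤ s * Real.cosh s := by
    intro s hs
    have hd : ∀ y : ℝ, HasDerivAt (fun y => y * Real.cosh y - Real.sinh y)
        (1 * Real.cosh y + y * Real.sinh y - Real.cosh y) y := fun y =>
      ((hasDerivAt_id y).mul (Real.hasDerivAt_cosh y)).sub (Real.hasDerivAt_sinh y)
    have hm : MonotoneOn (fun y => y * Real.cosh y - Real.sinh y) (Set.Ici (0:ℝ)) := by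
      apply monotoneOn_of_deriv_nonneg (convex_Ici 0)
      · exact fun y _ => (hd y).continuousAt.continuousWithinAt
      · exact fun y _ => (hd y).differentiableAt.differentiableWithinAt
      · intro y hy
        rw [interior_Ici] at hy
        rw [(hd y).deriv]
        have := mul_nonneg (le_of_lt hy) (Real.sinh_nonneg_iff.2 (le_of_lt hy))
        linarith
    have := hm (Set.mem_Ici.2 le_rfl) (Set.mem_Ici.2 hs) hs
    simp at this
    linarith
  have pos : ∀ s : ℝ, 0 ≤ s → (Real.sinh s - s) ^ 2 ≤ s ^ 2 * (Real.cosh s - 1) ^ 2 := by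
    intro s hs
    rw [← mul_pow]
    have := Real.self_le_sinh_iff.2 hs
    have := key s hs
    apply pow_le_pow_left₀ <;> linarith
  rcases le_total 0 t with h | h
  · exact pos t h
  · have := pos (-t) (by linarith)
    rw [Real.sinh_neg, Real.cosh_neg] at this
    nlinarith

theorem sq_le_cosh (t : ℝ) : t ^ 2 ≤ 2 * (Real.cosh t - 1) := by
  have h2 : Real.cosh t = 1 + 2 * Real.sinh (t/2) ^ 2 := by
    have := Real.cosh_two_mul (t/2)
    rw [mul_div_cancel₀ t two_ne_zero] at this
    have := Real.cosh_sq (t/2)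
    linarith
  have h3 : (t/2)^2 ≤ Real.sinh (t/2) ^ 2 := by
    rcases le_total 0 t with h | h
    · have := Real.self_le_sinh_iff.2 (by linarith : 0 ≤ t/2)
      nlinarith
    · have := Real.sinh_le_self_iff.2 (by linarith : t/2 ≤ 0)
      nlinarith
  nlinarith

theorem cosh_upper (r : ℝ) (hr : r ^ 2 ≤ 1/2) : 2 * (Real.cosh r - 1) ≤ 4/3 * r ^ 2 := by
  have h1 := Real.cosh_le_exp_half_sq r
  have h2 := Real.abs_exp_sub_one_sub_id_le (x := r^2/2)
    (by rw [abs_of_nonneg (by positivity)]; linarith)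
  have h3 := (abs_le.1 h2).2
  have := sq_nonneg r
  nlinarith

theorem diverg_eq {m : ℕ} (u v : Fin m → ℝ) :
    diverg u v = ∑ i, 2 * (Real.cosh (u i - v i) - 1) := by
  have : ∀ i, 2 * (Real.cosh (u i - v i) - 1) =
      Real.exp (u i) * Real.exp (-v i) + Real.exp (-u i) * Real.exp (v i) - 2 := by
    intro i
    rw [Real.cosh_eq, ← Real.exp_add, ← Real.exp_add]
    ring_nf
  simp only [this, Finset.sum_sub_distrib, Finset.sum_add_distrib]
  simp [diverg]
  ring

theorem newton_ineq {m n : ℕ} (A : Matrix (Fin m) (Fin n) ℝ) (b : Fin m → ℝ) (c : Fin n → ℝ)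
    (W : Matrix (Fin n) (Fin n) ℝ) (hW : W.PosSemidef)
    (μ : ℝ) (hμ : 0 < μ) (vhat : Fin m → ℝ) (xhat : Fin n → ℝ)
    (hcent : IsCentered A b c W μ vhat xhat) (v d : Fin m → ℝ) (x : Fin n → ℝ)
    (hN : IsNewton A b c W μ v d x) :
    ∑ i, (d i - Real.sinh (vhat i - v i)) ^ 2 ≤ ∑ i, (Real.cosh (vhat i - v i) - 1) ^ 2 := by
  obtain ⟨c1, c2⟩ := hcent
  obtain ⟨n1, n2⟩ := hN
  set p := expV v + expV v * d - expV vhat with hp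
  set q := expV (-v) - expV (-v) * d - expV (-vhat) with hq
  have e1 : Real.sqrt μ • (Aᵀ).mulVec p = W.mulVec (x - xhat) := by
    rw [hp, Matrix.mulVec_sub, smul_sub, n1, c1, Matrix.mulVec_sub]; abel
  have e2 : Real.sqrt μ • q = A.mulVec (x - xhat) := by
    rw [hq, smul_sub, n2, c2, Matrix.mulVec_sub]; abel
  have hs : 0 < Real.sqrt μ := Real.sqrt_pos.2 hμ
  have e3 : 0 ≤ Real.sqrt μ * Real.sqrt μ * (p ⬝ᵥ q) := by
    have h := hW.dotProduct_mulVec_nonneg (x - xhat)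
    rw [← e1] at h
    have e : Real.sqrt μ * Real.sqrt μ * (p ⬝ᵥ q) =
        star (x - xhat) ⬝ᵥ Real.sqrt μ • (Aᵀ).mulVec p := by
      rw [dotProduct_smul, Matrix.dotProduct_mulVec, Matrix.vecMul_transpose, star_trivial, ← e2,
        smul_dotProduct, dotProduct_comm q p]
      simp [mul_assoc]
    rw [e]; exact h
  have e4 : 0 ≤ p ⬝ᵥ q := nonneg_of_mul_nonneg_right e3 (by positivity)
  have e5 : p ⬝ᵥ q = ∑ i, ((Real.cosh (vhat i - v i) - 1) ^ 2
      - (d i - Real.sinh (vhat i - v i)) ^ 2) := by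
    rw [dotProduct]
    refine Finset.sum_congr rfl fun i _ => ?_
    simp only [hp, hq, expV, Pi.add_apply, Pi.sub_apply, Pi.mul_apply, Pi.neg_apply]
    rw [Real.cosh_eq, Real.sinh_eq, neg_sub, Real.exp_sub, Real.exp_sub, Real.exp_neg, Real.exp_neg]
    have := (Real.exp_pos (v i)).ne'
    have := (Real.exp_pos (vhat i)).ne'
    field_simp
    ring
  rw [e5, Finset.sum_sub_distrib] at e4
  linarith

theorem newton_step {m : ℕ} (vhat v d : Fin m → ℝ)
    (hN : ∑ i, (d i - Real.sinh (vhat i - v i)) ^ 2 ≤ ∑ i, (Real.cosh (vhat i - v i) - 1) ^ 2)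
    (hh : diverg vhat v ≤ 1/2) : diverg vhat (v + d) ≤ diverg vhat v ^ 2 := by
  rw [diverg_eq] at hh
  rw [diverg_eq, diverg_eq]
  simp only [← Finset.mul_sum] at hh ⊢
  have ha : ∀ i ∈ Finset.univ, 0 ≤ Real.cosh (vhat i - v i) - 1 :=
    fun i _ => sub_nonneg.2 (Real.one_le_cosh _)
  have ha4 : ∀ i, Real.cosh (vhat i - v i) - 1 ≤ 1/4 := fun i => by
    have := Finset.single_le_sum ha (Finset.mem_univ i)
    linarith
  have hsq : ∑ i, (Real.cosh (vhat i - v i) - 1) ^ 2 ≤ (∑ i, (Real.cosh (vhat i - v i) - 1)) ^ 2 :=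
    Finset.sum_sq_le_sq_sum_of_nonneg ha
  have hsum0 := Finset.sum_nonneg ha
  have hr : ∑ i, (vhat i - (v + d) i) ^ 2 ≤ 3 * ∑ i, (Real.cosh (vhat i - v i) - 1) ^ 2 := by
    have : ∀ i ∈ Finset.univ, (vhat i - (v + d) i) ^ 2 ≤ (Real.cosh (vhat i - v i) - 1) ^ 2
        + 2 * (d i - Real.sinh (vhat i - v i)) ^ 2 := by
      intro i hi
      have b1 := sinh_sub_bound (vhat i - v i)
      have b2 := sq_le_cosh (vhat i - v i)
      have b3 : (vhat i - v i) ^ 2 * (Real.cosh (vhat i - v i) - 1) ^ 2 ≤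
          1/2 * (Real.cosh (vhat i - v i) - 1) ^ 2 :=
        mul_le_mul_of_nonneg_right (by linarith [ha4 i]) (sq_nonneg _)
      have b4 := sq_nonneg ((d i - Real.sinh (vhat i - v i)) -
        (Real.sinh (vhat i - v i) - (vhat i - v i)))
      simp only [Pi.add_apply]
      nlinarith
    have := Finset.sum_le_sum this
    rw [Finset.sum_add_distrib, ← Finset.mul_sum] at this
    linarith
  have hfin : ∑ i, 2 * (Real.cosh (vhat i - (v + d) i) - 1) ≤
      ∑ i, 4/3 * (vhat i - (v + d) i) ^ 2 := by
    refine Finset.sum_le_sum fun i hi => cosh_upper _ ?_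
    have := Finset.single_le_sum (f := fun i => (vhat i - (v + d) i) ^ 2)
      (fun i _ => sq_nonneg _) (Finset.mem_univ i)
    nlinarith
  rw [← Finset.mul_sum, ← Finset.mul_sum] at hfin
  nlinarith

/-- fix `μ > 0` with centered point `v̂(μ)`, and full-Newton-step
iterates `v_{i+1} = v_i + d(v_i, μ)`. If `h(v̂(μ), v₀) ≤ θ ≤ 1/2`, then
`h(v̂(μ), v_i) ≤ θ^(2^i)` for all `i`. -/
theorem stmt_11 {m n : ℕ} (A : Matrix (Fin m) (Fin n) ℝ) (b : Fin m → ℝ) (c : Fin n → ℝ)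
    (W : Matrix (Fin n) (Fin n) ℝ) (hW : W.PosSemidef) (hAW : (Aᵀ * A + W).PosDef)
    (μ : ℝ) (hμ : 0 < μ) (vhat : Fin m → ℝ) (xhat : Fin n → ℝ)
    (hcent : IsCentered A b c W μ vhat xhat)
    (v : ℕ → Fin m → ℝ) (d : ℕ → Fin m → ℝ) (x : ℕ → Fin n → ℝ)
    (hnewton : ∀ i, IsNewton A b c W μ (v i) (d i) (x i))
    (hrec : ∀ i, v (i + 1) = v i + d i)
    (θ : ℝ) (hθ : θ ≤ 1 / 2) (h0 : diverg vhat (v 0) ≤ θ) :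
    ∀ i, diverg vhat (v i) ≤ θ ^ (2 ^ i) := by
  have hnn : ∀ i, 0 ≤ diverg vhat (v i) := fun i => by
    rw [diverg_eq]
    exact Finset.sum_nonneg fun j _ => by linarith [Real.one_le_cosh (vhat j - v i j)]
  have hθ0 : 0 ≤ θ := (hnn 0).trans h0
  intro i
  induction i with
  | zero => simpa using h0
  | succ k ih =>
    have hle : θ ^ (2 ^ k) ≤ θ := pow_le_of_le_one hθ0 (by linarith) (by positivity)
    have hs := newton_step vhat (v k) (d k)
      (newton_ineq A b c W hW μ hμ vhat xhat hcent (v k) (d k) (x k) (hnewton k))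
      (ih.trans (hle.trans hθ))
    rw [hrec, pow_succ 2 k, pow_mul]
    exact hs.trans (pow_le_pow_left₀ (hnn k) ih 2)
end
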